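/- Fix α > 0 and p ∈ ℕ. For each integer N > p, let (a_0, …, a_p) be i.i.d. standard Gaussian random variables and let b_1, …, b_p be independent random variables where b_j is distributed as the square root of a Gamma(α(N−j)/N, 1) random variable (i.e., b_j ∼ χ̃_{2(N−j)α/N}), all variables independent; let T_N be the (p+1)×(p+1) random symmetric tridiagonal matrix with diagonal entries a_j and off-diagonal entries T_{j−1,j} = T_{j,j−1} = b_j, and set m_p(N) = E[(T_N^{2p})_{0,0}]. Then m_p(N) → u_p(α) as N → ∞. (This is the convergence of the mean 2p-th moment at the corner of the Gaussian β-ensemble tridiagonal model with β = 2α/N to the corresponding moment of the Jacobi matrix A_α.) -/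

import Mathlib

open MeasureTheory ProbabilityTheory

/-- The `N × N` real symmetric tridiagonal matrix with zero diagonal and
off-diagonal entries `M_{k,k+1} = M_{k+1,k} = √(α + k + 1)` for `0 ≤ k ≤ N - 2`. -/
noncomputable def jacobiM (α : ℝ) (N : ℕ) : Matrix (Fin N) (Fin N) ℝ := fun i j =>
  if (i : ℕ) + 1 = (j : ℕ) then Real.sqrt (α + (i : ℕ) + 1)
  else if (j : ℕ) + 1 = (i : ℕ) then Real.sqrt (α + (j : ℕ) + 1)
  else 0

/-- `u n (α) = A_α^{2n}(1,1)`, computed as the `(0,0)` entry of the `2n`-th power of the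
`(n+1) × (n+1)` truncation of the Jacobi matrix `A_α`. -/
noncomputable def u (α : ℝ) (n : ℕ) : ℝ := ((jacobiM α (n + 1)) ^ (2 * n)) 0 0

/-- The `χ̃_{2s}` distribution: the law of the square root of a `Gamma(s, 1)` random
variable, i.e. the pushforward of the `Gamma(s,1)` measure under the square-root map
(with density `(2/Γ(s)) u^{2s-1} e^{-u²}` on `(0,∞)`). -/
noncomputable def tildeChiMeasure (s : ℝ) : Measure ℝ :=
  (gammaMeasure s 1).map Real.sqrt

/-- The `(p+1) × (p+1)` symmetric tridiagonal matrix with diagonal `a_0, …, a_p` and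
off-diagonal entries `T_{j-1,j} = T_{j,j-1} = b_j` for `1 ≤ j ≤ p` (here `b` is indexed by
`Fin p`, with `b i` playing the role of `b_{i+1}`). -/
noncomputable def tridiagOf {p : ℕ} (a : Fin (p + 1) → ℝ) (b : Fin p → ℝ) :
    Matrix (Fin (p + 1)) (Fin (p + 1)) ℝ := fun i j =>
  if i = j then a i
  else if h : (i : ℕ) + 1 = (j : ℕ) then b ⟨i, by have := j.isLt; omega⟩
  else if h2 : (j : ℕ) + 1 = (i : ℕ) then b ⟨j, by have := i.isLt; omega⟩
  else 0

section FormalSeries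

open PowerSeries Finset

/-- The formal series `∑ r, X ^ r * f r`. -/
noncomputable def shiftSum (f : ℕ → PowerSeries ℝ) : PowerSeries ℝ :=
  PowerSeries.mk fun n => ∑ ij ∈ antidiagonal n, coeff ij.2 (f ij.1)

lemma shiftSum_add (f g : ℕ → PowerSeries ℝ) :
    shiftSum (fun r => f r + g r) = shiftSum f + shiftSum g := by
  ext n; simp [shiftSum, sum_add_distrib]

lemma shiftSum_smul (c : ℝ) (f : ℕ → PowerSeries ℝ) :
    shiftSum (fun r => c • f r) = c • shiftSum f := by
  ext n; simp [shiftSum, mul_sum]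

lemma shiftSum_eq_add_X_mul (f : ℕ → PowerSeries ℝ) :
    shiftSum f = f 0 + X * shiftSum (fun r => f (r + 1)) := by
  ext n
  cases n with
  | zero => simp [shiftSum]
  | succ n => simp [shiftSum, Nat.antidiagonal_succ, coeff_succ_X_mul]

lemma shiftSum_mul_left (c : PowerSeries ℝ) (f : ℕ → PowerSeries ℝ) :
    shiftSum (fun r => c * f r) = c * shiftSum f := by
  have step (f : ℕ → PowerSeries ℝ) : shiftSum (fun r => c * f r) - c * shiftSum f =
      X * (shiftSum (fun r => c * f (r + 1)) - c * shiftSum (fun r => f (r + 1))) := by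
    rw [shiftSum_eq_add_X_mul (fun r => c * f r), shiftSum_eq_add_X_mul f]
    ring
  rw [← sub_eq_zero]
  ext n
  induction n generalizing f with
  | zero => rw [step]; simp
  | succ n ih => rw [step, coeff_succ_X_mul, ih]; simp

lemma shiftSum_multichoose_succ (e : ℕ → PowerSeries ℝ) (m : ℕ) :
    shiftSum (fun r => (Nat.multichoose (m + 1) r : ℝ) • e r) =
      shiftSum (fun r => (Nat.multichoose m r : ℝ) • e r) +
        X * shiftSum (fun r => (Nat.multichoose (m + 1) r : ℝ) • e (r + 1)) := by
  rw [shiftSum_eq_add_X_mul, shiftSum_eq_add_X_mul (fun r => (Nat.multichoose m r : ℝ) • e r),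
    add_assoc, ← mul_add, ← shiftSum_add]
  simp [Nat.multichoose_succ_succ, add_smul]

lemma shiftSum_multichoose_zero (e : ℕ → PowerSeries ℝ) :
    shiftSum (fun r => (Nat.multichoose 0 r : ℝ) • e r) = e 0 := by
  rw [shiftSum_eq_add_X_mul]
  have h := shiftSum_smul 0 fun _ => (0 : PowerSeries ℝ)
  simp only [smul_zero, zero_smul] at h
  simp [h]

/-- The series whose coefficients are weighted path counts for the Jacobi matrix with
off-diagonal weights `α + k + 1`. -/
noncomputable def pathCount (α : ℝ) : ℕ → ℕ → ℝ
  | 0, 0 => 1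
  | 0, _ + 1 => 0
  | _ + 1, 0 => 0
  | m + 1, n + 1 => pathCount α m n + (α + m + 1) * pathCount α (m + 2) n
termination_by _ n => n

lemma pathCount_succ_succ (α : ℝ) (m n : ℕ) : pathCount α (m + 1) (n + 1) =
    pathCount α m n + (α + m + 1) * pathCount α (m + 2) n := by
  rw [pathCount]

/-- The generating series of `pathCount α m`. -/
noncomputable def pathSeries (α : ℝ) (m : ℕ) : PowerSeries ℝ :=
  PowerSeries.mk (pathCount α m)

lemma pathSeries_zero (α : ℝ) : pathSeries α 0 = 1 := by
  ext n
  cases n <;> simp [pathSeries, pathCount, coeff_one]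

lemma pathSeries_succ (α : ℝ) (m : ℕ) :
    pathSeries α (m + 1) =
      X * (pathSeries α m + (α + m + 1) • pathSeries α (m + 2)) := by
  ext n
  cases n with
  | zero => simp [pathSeries, pathCount]
  | succ n =>
    rw [coeff_succ_X_mul]
    simp [pathSeries, pathCount_succ_succ]

lemma eq_pathSeries_of_recurrence {α : ℝ} {F : ℕ → PowerSeries ℝ} (h0 : F 0 = 1)
    (h : ∀ m, F (m + 1) = X * (F m + (α + m + 1) • F (m + 2))) : F = pathSeries α := by
  have key : ∀ n m, coeff n (F m) = coeff n (pathSeries α m) := by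
    intro n
    induction n with
    | zero =>
      intro m
      cases m with
      | zero => rw [h0, pathSeries_zero]
      | succ m => rw [h, pathSeries_succ]; simp
    | succ n ih =>
      intro m
      cases m with
      | zero => rw [h0, pathSeries_zero]
      | succ m => rw [h, pathSeries_succ]; simp [coeff_succ_X_mul, ih]
  funext m
  ext n
  exact key n m

/-- The linear functional on polynomials in three variables sending the monomial
`X₀ ^ i * X₁ ^ j * X₂ ^ k` to `(μ i * γ j) • ψ k`. -/
noncomputable def momentFunctional (μ γ : ℕ → ℝ) (ψ : ℕ → PowerSeries ℝ) :
    MvPolynomial (Fin 3) ℝ →ₗ[ℝ] PowerSeries ℝ :=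
  (MvPolynomial.basisMonomials (Fin 3) ℝ).constr ℝ fun s => (μ (s 0) * γ (s 1)) • ψ (s 2)

lemma momentFunctional_monomial (μ γ : ℕ → ℝ) (ψ : ℕ → PowerSeries ℝ) (s : Fin 3 →₀ ℕ) (c : ℝ) :
    momentFunctional μ γ ψ (MvPolynomial.monomial s c) =
      (c * (μ (s 0) * γ (s 1))) • ψ (s 2) := by
  have h : MvPolynomial.monomial s c = c • MvPolynomial.basisMonomials (Fin 3) ℝ s := by
    simp [MvPolynomial.coe_basisMonomials, MvPolynomial.smul_monomial]
  rw [h, map_smul, momentFunctional, Module.Basis.constr_basis, smul_smul]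

lemma momentFunctional_pow_mul (μ γ : ℕ → ℝ) (ψ : ℕ → PowerSeries ℝ) (i j k : ℕ) :
    momentFunctional μ γ ψ (MvPolynomial.X 0 ^ i * MvPolynomial.X 1 ^ j * MvPolynomial.X 2 ^ k) =
      (μ i * γ j) • ψ k := by
  have h : (MvPolynomial.X 0 ^ i * MvPolynomial.X 1 ^ j * MvPolynomial.X 2 ^ k :
      MvPolynomial (Fin 3) ℝ) = MvPolynomial.monomial
        (Finsupp.single 0 i + Finsupp.single 1 j + Finsupp.single 2 k) 1 := by
    simp [MvPolynomial.X_pow_eq_monomial, MvPolynomial.monomial_mul]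
  rw [h, momentFunctional_monomial]
  simp

section IntegrationByParts

variable {μ γ : ℕ → ℝ} {ψ : ℕ → PowerSeries ℝ}

lemma momentFunctional_X_zero_mul (hμ : ∀ i, μ (i + 1) = i * μ (i - 1))
    (f : MvPolynomial (Fin 3) ℝ) :
    momentFunctional μ γ ψ (MvPolynomial.X 0 * f) =
      momentFunctional μ γ ψ (MvPolynomial.pderiv 0 f) := by
  induction f using MvPolynomial.induction_on' with
  | add p q hp hq => simp [mul_add, hp, hq]
  | monomial s c =>
    rw [mul_comm, ← pow_one (MvPolynomial.X 0), MvPolynomial.X_pow_eq_monomial,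
      MvPolynomial.monomial_mul, MvPolynomial.pderiv_monomial, momentFunctional_monomial,
      momentFunctional_monomial]
    congr 1
    · simp [hμ]; ring
    · simp

lemma momentFunctional_X_one_mul {α : ℝ} (hγ : ∀ j, γ (j + 1) = (α + j) * γ j)
    (f : MvPolynomial (Fin 3) ℝ) :
    momentFunctional μ γ ψ (MvPolynomial.X 1 * f) = α • momentFunctional μ γ ψ f +
      momentFunctional μ γ ψ (MvPolynomial.X 1 * MvPolynomial.pderiv 1 f) := by
  induction f using MvPolynomial.induction_on' with
  | add p q hp hq => simp only [mul_add, map_add, hp, hq, smul_add]; abel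
  | monomial s c =>
    rw [MvPolynomial.X_mul_pderiv_monomial, map_nsmul, mul_comm,
      ← pow_one (MvPolynomial.X 1), MvPolynomial.X_pow_eq_monomial, MvPolynomial.monomial_mul,
      momentFunctional_monomial, momentFunctional_monomial, ← Nat.cast_smul_eq_nsmul ℝ,
      smul_smul, smul_smul, ← add_smul]
    congr 1
    · simp [hγ]; ring
    · simp

lemma momentFunctional_X_two_mul {α : ℝ}
    (hψ : ∀ k, ψ (k + 1) = X * (ψ k + (α + k + 1) • ψ (k + 2)))
    (f : MvPolynomial (Fin 3) ℝ) :
    momentFunctional μ γ ψ (MvPolynomial.X 2 * f) = X * (momentFunctional μ γ ψ f +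
      (α + 1) • momentFunctional μ γ ψ (MvPolynomial.X 2 ^ 2 * f) +
      momentFunctional μ γ ψ (MvPolynomial.X 2 ^ 3 * MvPolynomial.pderiv 2 f)) := by
  induction f using MvPolynomial.induction_on' with
  | add p q hp hq => simp only [mul_add, map_add, hp, hq, smul_add]; ring
  | monomial s c =>
    have h3 : (MvPolynomial.X 2 ^ 3 * MvPolynomial.pderiv 2 (MvPolynomial.monomial s c) :
        MvPolynomial (Fin 3) ℝ) =
        s 2 • (MvPolynomial.X 2 ^ 2 * MvPolynomial.monomial s c) := by
      rw [pow_succ, mul_assoc, MvPolynomial.X_mul_pderiv_monomial, mul_smul_comm]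
    rw [h3, map_nsmul, ← pow_one (MvPolynomial.X 2 : MvPolynomial (Fin 3) ℝ), ← pow_mul,
      MvPolynomial.X_pow_eq_monomial, MvPolynomial.X_pow_eq_monomial,
      MvPolynomial.monomial_mul, MvPolynomial.monomial_mul, momentFunctional_monomial,
      momentFunctional_monomial, momentFunctional_monomial, ← Nat.cast_smul_eq_nsmul ℝ]
    simp only [Finsupp.add_apply, Finsupp.single_apply]
    simp only [Fin.reduceEq, ↓reduceIte, zero_add, one_mul]
    rw [add_comm 1, hψ, add_comm 2]
    simp only [PowerSeries.smul_eq_C_mul, map_add, map_one, map_natCast]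
    ring

end IntegrationByParts

/-- The moments of `X₀ + X₁ * X₂` under `momentFunctional μ γ ψ`. -/
noncomputable def mixedMoment (μ γ : ℕ → ℝ) (ψ : ℕ → PowerSeries ℝ) (r : ℕ) : PowerSeries ℝ :=
  ∑ i ∈ range (r + 1), (r.choose i * (μ i * γ (r - i))) • ψ (r - i)

lemma momentFunctional_add_mul_pow (μ γ : ℕ → ℝ) (ψ : ℕ → PowerSeries ℝ) (r : ℕ) :
    momentFunctional μ γ ψ ((MvPolynomial.X 0 + MvPolynomial.X 1 * MvPolynomial.X 2) ^ r) =
      mixedMoment μ γ ψ r := by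
  rw [add_pow, map_sum, mixedMoment]
  refine sum_congr rfl fun i _ => ?_
  rw [mul_pow, mul_comm, ← nsmul_eq_mul, map_nsmul, ← mul_assoc, momentFunctional_pow_mul,
    ← Nat.cast_smul_eq_nsmul ℝ, smul_smul]

lemma mixedMoment_recurrence {α : ℝ} {μ γ : ℕ → ℝ} {ψ : ℕ → PowerSeries ℝ}
    (hμ : ∀ i, μ (i + 1) = i * μ (i - 1)) (hγ : ∀ j, γ (j + 1) = (α + j) * γ j)
    (hψ : ∀ k, ψ (k + 1) = X * (ψ k + (α + k + 1) • ψ (k + 2))) (r : ℕ) :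
    mixedMoment μ γ ψ (r + 1) = (r : ℝ) • mixedMoment μ γ ψ (r - 1) +
      X * (mixedMoment μ γ ψ (r + 2) + (α - r - 1) • mixedMoment μ γ ψ r) := by
  simp only [← momentFunctional_add_mul_pow]
  set E := momentFunctional μ γ ψ
  set a : MvPolynomial (Fin 3) ℝ := MvPolynomial.X 0 with ha
  set g : MvPolynomial (Fin 3) ℝ := MvPolynomial.X 1 with hg
  set y : MvPolynomial (Fin 3) ℝ := MvPolynomial.X 2 with hy
  have q0 (n : ℕ) : MvPolynomial.pderiv 0 ((a + g * y) ^ n) = n * (a + g * y) ^ (n - 1) := by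
    simp [Derivation.leibniz_pow, ha, hg, hy, MvPolynomial.pderiv_X]
  have q1 (n : ℕ) : MvPolynomial.pderiv 1 ((a + g * y) ^ n) = n * (a + g * y) ^ (n - 1) * y := by
    simp [Derivation.leibniz_pow, ha, hg, hy, MvPolynomial.pderiv_X, mul_assoc]
  have q2 (n : ℕ) : MvPolynomial.pderiv 2 ((a + g * y) ^ n) = n * (a + g * y) ^ (n - 1) * g := by
    simp [Derivation.leibniz_pow, ha, hg, hy, MvPolynomial.pderiv_X, mul_assoc]
  set q := a + g * y with hq
  set R : MvPolynomial (Fin 3) ℝ := (r : MvPolynomial (Fin 3) ℝ) with hR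
  -- Stein's identity for powers of `q`
  have hs (n : ℕ) : E (a * q ^ n) = (n : ℝ) • E (q ^ (n - 1)) := by
    rw [momentFunctional_X_zero_mul hμ, q0, ← nsmul_eq_mul, map_nsmul, Nat.cast_smul_eq_nsmul]
  have hexp (n : ℕ) : E (q ^ (n + 1)) = (n : ℝ) • E (q ^ (n - 1)) + E (g * y * q ^ n) := by
    rw [← hs, ← map_add, ← add_mul, ← hq, pow_succ']
  have d0 : MvPolynomial.pderiv 0 (g * y * q ^ r) = g * (R * q ^ (r - 1) * y) := by
    simp only [Derivation.leibniz, q0]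
    simp [hR, hg, hy, MvPolynomial.pderiv_X]
    ring
  have d1 : MvPolynomial.pderiv 1 (g * y ^ 2 * q ^ r) =
      y ^ 2 * q ^ r + g * y ^ 3 * (R * q ^ (r - 1)) := by
    simp only [Derivation.leibniz, Derivation.leibniz_pow, q1]
    simp [hR, hg, hy, MvPolynomial.pderiv_X]
    ring
  have d2 : MvPolynomial.pderiv 2 (g * q ^ r) = g ^ 2 * (R * q ^ (r - 1)) := by
    simp only [Derivation.leibniz, q2]
    simp [hR, hg, MvPolynomial.pderiv_X]
    ring
  have hstein : E (g * y * q ^ (r + 1)) - E (g * (g * y ^ 2 * q ^ r)) =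
      E (g * (R * q ^ (r - 1) * y)) := by
    rw [← d0, ← momentFunctional_X_zero_mul hμ, ← map_sub]
    congr 1
    rw [← ha, hq]
    ring
  have hgamma : E (g * q ^ r) = α • E (q ^ r) + E (g * (R * q ^ (r - 1) * y)) := by
    rw [momentFunctional_X_one_mul hγ, q1]
  have hgamma' : E (g * (g * y ^ 2 * q ^ r)) = α • E (g * y ^ 2 * q ^ r) +
      (E (g * y ^ 2 * q ^ r) + E (g * (g * y ^ 3 * (R * q ^ (r - 1))))) := by
    rw [momentFunctional_X_one_mul hγ, d1, ← map_add, ← hg]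
    congr 2
    ring
  have hpath : E (g * y * q ^ r) = X * (E (g * q ^ r) + (α + 1) • E (g * y ^ 2 * q ^ r) +
      E (g * (g * y ^ 3 * (R * q ^ (r - 1))))) := by
    rw [show g * y * q ^ r = y * (g * q ^ r) by ring, momentFunctional_X_two_mul hψ, d2, ← hy,
      show y ^ 2 * (g * q ^ r) = g * y ^ 2 * q ^ r by ring,
      show y ^ 3 * (g ^ 2 * (R * q ^ (r - 1))) = g * (g * y ^ 3 * (R * q ^ (r - 1))) by ring]
  have h1 := hexp r
  have h2 := hexp (r + 1)
  simp only [PowerSeries.smul_eq_C_mul, map_add, map_sub, map_one, map_natCast, Nat.cast_add,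
    Nat.cast_one, Nat.add_sub_cancel] at *
  rw [h1, show r + 2 = r + 1 + 1 from rfl, h2]
  linear_combination hpath + X * hgamma - X * hstein - X * hgamma'

lemma multichoose_absorb (m r : ℕ) :
    (r + 1) * Nat.multichoose (m + 1) (r + 1) = (m + 1 + r) * Nat.multichoose (m + 1) r := by
  rw [Nat.multichoose_eq, Nat.multichoose_eq]
  have := Nat.add_one_mul_choose_eq (m + r) r
  rw [show m + 1 + (r + 1) - 1 = m + r + 1 by omega, show m + 1 + r - 1 = m + r by omega]
  linarith

/-- The operator describing how the moments of `X * (1 - X * (a + g * Y))⁻¹` depend on those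
of `a`, `g` and `Y`. -/
noncomputable def resolventMoment (μ γ : ℕ → ℝ) (ψ : ℕ → PowerSeries ℝ) (m : ℕ) :
    PowerSeries ℝ :=
  X ^ m * shiftSum fun r => (Nat.multichoose m r : ℝ) • mixedMoment μ γ ψ r

lemma resolventMoment_pathSeries {α : ℝ} {μ γ : ℕ → ℝ} (hμ0 : μ 0 = 1) (hγ0 : γ 0 = 1)
    (hμ : ∀ i, μ (i + 1) = i * μ (i - 1)) (hγ : ∀ j, γ (j + 1) = (α + j) * γ j) :
    resolventMoment μ γ (pathSeries α) = pathSeries α := by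
  set e := mixedMoment μ γ (pathSeries α) with he
  have hrec := mixedMoment_recurrence hμ hγ (pathSeries_succ α)
  rw [← he] at hrec
  apply eq_pathSeries_of_recurrence
  · simp [resolventMoment, shiftSum_multichoose_zero, mixedMoment, hμ0, hγ0, pathSeries_zero]
  · intro m
    simp only [resolventMoment, ← he]
    have lower : shiftSum (fun r => ((Nat.multichoose (m + 2) r : ℝ) * r) • e (r - 1)) =
        X * shiftSum (fun r => ((m + 2 + r : ℝ) * (Nat.multichoose (m + 2) r : ℝ)) • e r) := by
      rw [shiftSum_eq_add_X_mul]
      simp only [Nat.cast_zero, mul_zero, zero_smul, zero_add, Nat.add_sub_cancel]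
      congr 2
      funext r
      have := multichoose_absorb (m + 1) r
      congr 1
      rw [mul_comm]
      exact_mod_cast this
    have main : shiftSum (fun r => (Nat.multichoose (m + 2) r : ℝ) • e (r + 1)) =
        X * shiftSum (fun r => (Nat.multichoose (m + 2) r : ℝ) • e (r + 2)) +
        (α + m + 1) • (X * shiftSum (fun r => (Nat.multichoose (m + 2) r : ℝ) • e r)) := by
      calc _ = shiftSum (fun r => ((Nat.multichoose (m + 2) r : ℝ) * r) • e (r - 1) +
            (X * ((Nat.multichoose (m + 2) r : ℝ) • e (r + 2)) +
              X * (((Nat.multichoose (m + 2) r : ℝ) * (α - r - 1)) • e r))) := by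
            congr 1
            funext r
            rw [hrec r]
            simp only [smul_add, mul_add, smul_smul, mul_smul_comm]
        _ = _ := by
            rw [shiftSum_add, shiftSum_add, lower, shiftSum_mul_left, shiftSum_mul_left,
              ← mul_smul_comm, ← shiftSum_smul, add_left_comm,
              ← mul_add X (shiftSum _) (shiftSum _), ← shiftSum_add]
            congr 3
            funext r
            rw [← add_smul, smul_smul]
            congr 1
            ring
    rw [shiftSum_multichoose_succ (fun r => e (r + 1)) (m + 1)] at main
    have main' := add_left_cancel ((add_comm _ _).trans main)
    rw [shiftSum_multichoose_succ e m, main']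
    simp only [PowerSeries.smul_eq_C_mul]
    ring

end FormalSeries

section Moments

open Polynomial

lemma integrable_pow_gaussianReal (i : ℕ) : Integrable (fun x : ℝ => x ^ i) (gaussianReal 0 1) :=
  integrable_pow_of_mem_interior_integrableExpSet (X := id) (by simp) i

/-- Stein's identity for monomials. -/
lemma integral_pow_succ_gaussianReal (i : ℕ) :
    ∫ x, x ^ (i + 1) ∂gaussianReal 0 1 = i * ∫ x, x ^ (i - 1) ∂gaussianReal 0 1 := by
  have hint (k : ℕ) : Integrable fun x : ℝ => gaussianPDFReal 0 1 x * x ^ k := by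
    have h := integrable_pow_gaussianReal k
    rw [gaussianReal_of_var_ne_zero 0 one_ne_zero, integrable_withDensity_iff_integrable_smul'
      (measurable_gaussianPDF 0 1) (ae_of_all _ fun _ => gaussianPDF_lt_top)] at h
    simpa [toReal_gaussianPDF] using h
  have hderiv (x : ℝ) : HasDerivAt (gaussianPDFReal 0 1) (-(x * gaussianPDFReal 0 1 x)) x := by
    have h : HasDerivAt (fun y : ℝ => (√(2 * Real.pi * (1 : NNReal)))⁻¹ *
        Real.exp (-(y - 0) ^ 2 / (2 * (1 : NNReal)))) _ x :=
      (((((hasDerivAt_id' x).sub_const 0).pow 2).neg.div_const _).exp).const_mul _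
    rw [gaussianPDFReal_def]
    convert h using 1
    simp
    ring
  have h0 := integral_eq_zero_of_hasDerivAt_of_integrable
    (f := fun x : ℝ => gaussianPDFReal 0 1 x * x ^ i)
    (f' := fun x => i * (gaussianPDFReal 0 1 x * x ^ (i - 1)) - gaussianPDFReal 0 1 x * x ^ (i + 1))
    (fun x => by
      convert! (hderiv x).mul (hasDerivAt_pow i x) using 1
      ring)
    (((hint _).const_mul _).sub (hint _)) (hint i)
  rw [integral_sub ((hint _).const_mul _) (hint _), integral_const_mul, sub_eq_zero] at h0
  simp only [integral_gaussianReal_eq_integral_smul one_ne_zero, smul_eq_mul]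
  exact h0.symm

lemma isProbabilityMeasure_tildeChiMeasure {s : ℝ} (hs : 0 < s) :
    IsProbabilityMeasure (tildeChiMeasure s) := by
  have := isProbabilityMeasure_gammaMeasure hs one_pos
  exact Measure.isProbabilityMeasure_map Real.continuous_sqrt.aemeasurable

lemma Gamma_add_natCast {s : ℝ} (hs : 0 < s) (j : ℕ) :
    Real.Gamma (s + j) = (ascPochhammer ℝ j).eval s * Real.Gamma s := by
  induction j with
  | zero => simp
  | succ j ih =>
    rw [Nat.cast_succ, ← add_assoc, Real.Gamma_add_one (by positivity), ih,
      ascPochhammer_succ_eval]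
    ring

lemma integrable_and_integral_pow_tildeChiMeasure {s : ℝ} (hs : 0 < s) (j : ℕ) :
    Integrable (fun x : ℝ => (x ^ 2) ^ j) (tildeChiMeasure s) ∧
      ∫ x, (x ^ 2) ^ j ∂tildeChiMeasure s = (ascPochhammer ℝ j).eval s := by
  have hmeas : AEStronglyMeasurable (fun x : ℝ => (x ^ 2) ^ j)
      (Measure.map Real.sqrt (gammaMeasure s 1)) :=
    (by fun_prop : Continuous fun x : ℝ => (x ^ 2) ^ j).aestronglyMeasurable
  have hfin : ∀ᵐ x : ℝ, gammaPDF s 1 x < ⊤ := ae_of_all _ fun _ => ENNReal.ofReal_lt_top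
  have hpdf : Measurable (gammaPDF s 1) := (measurable_gammaPDFReal s 1).ennreal_ofReal
  have hdens : (fun x : ℝ => (gammaPDF s 1 x).toReal • ((√x) ^ 2) ^ j) =ᵐ[volume]
      (Set.Ioi 0).indicator
        fun x => (Real.Gamma s)⁻¹ * (x ^ (s + j - 1) * Real.exp (-(1 * x))) := by
    filter_upwards [Measure.ae_ne volume (0 : ℝ)] with x hx
    rcases lt_or_gt_of_ne hx with hx | hx
    · rw [gammaPDF_of_neg hx, Set.indicator_of_notMem (by simpa using hx.le)]
      simp
    · rw [Set.indicator_of_mem (by simpa using hx), gammaPDF_of_nonneg hx.le,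
        ENNReal.toReal_ofReal (by positivity), Real.sq_sqrt hx.le, smul_eq_mul,
        add_sub_right_comm, Real.rpow_add_natCast hx.ne']
      simp
      ring
  have hint : IntegrableOn (fun x : ℝ => (Real.Gamma s)⁻¹ * (x ^ (s + j - 1) * Real.exp (-(1 * x))))
      (Set.Ioi 0) := by
    refine Integrable.const_mul ?_ _
    refine (Real.GammaIntegral_convergent (s := s + j) (by positivity)).congr_fun ?_
      measurableSet_Ioi
    intro x _
    simp [mul_comm]
  constructor
  · rw [tildeChiMeasure, integrable_map_measure hmeas Real.continuous_sqrt.aemeasurable,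
      gammaMeasure, integrable_withDensity_iff_integrable_smul' hpdf hfin]
    exact (integrable_congr hdens).2 (hint.integrable_indicator measurableSet_Ioi)
  · rw [tildeChiMeasure, integral_map Real.continuous_sqrt.aemeasurable hmeas, gammaMeasure,
      integral_withDensity_eq_integral_toReal_smul hpdf hfin, integral_congr_ae hdens,
      integral_indicator measurableSet_Ioi, integral_const_mul,
      Real.integral_rpow_mul_exp_neg_mul_Ioi (by positivity) one_pos, Gamma_add_natCast hs]
    have := (Real.Gamma_pos_of_pos hs).ne'
    field_simp
    simp

end Moments

section Decouple

lemma measurePreserving_head_head_tails {d : ℕ} (νa : Measure ℝ) [IsProbabilityMeasure νa]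
    (ν : Fin (d + 1) → Measure ℝ) [∀ i, IsProbabilityMeasure (ν i)] :
    MeasurePreserving
      (fun ω : (Fin (d + 2) → ℝ) × (Fin (d + 1) → ℝ) =>
        (ω.1 0, ω.2 0, Fin.tail ω.1, Fin.tail ω.2))
      ((Measure.pi fun _ : Fin (d + 2) => νa).prod (Measure.pi ν))
      (νa.prod ((ν 0).prod ((Measure.pi fun _ : Fin (d + 1) => νa).prod
        (Measure.pi (Fin.tail ν))))) := by
  have : ∀ i, IsProbabilityMeasure (Fin.tail ν i) := fun i => inferInstanceAs
    (IsProbabilityMeasure (ν i.succ))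
  have ha := measurePreserving_piFinSuccAbove (fun _ : Fin (d + 2) => νa) 0
  have hb := measurePreserving_piFinSuccAbove ν 0
  set A := Measure.pi fun _ : Fin (d + 1) => νa
  set B := Measure.pi (Fin.tail ν)
  have h1 := ha.prod hb
  have h2 := measurePreserving_prodAssoc νa A ((ν 0).prod B)
  have h3 := (measurePreserving_prodAssoc A (ν 0) B).symm
  have h4 := (Measure.measurePreserving_swap (μ := A) (ν := ν 0)).prod (MeasurePreserving.id B)
  have h5 := measurePreserving_prodAssoc (ν 0) A B
  exact ((MeasurePreserving.id νa).prod (h5.comp (h4.comp h3))).comp (h2.comp h1)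

end Decouple

section Resolvent

open PowerSeries Finset

lemma shiftSum_multichoose_pow (q : PowerSeries ℝ) (m : ℕ) :
    shiftSum (fun r => (Nat.multichoose m r : ℝ) • q ^ r) = ((1 - X * q)⁻¹) ^ m := by
  induction m with
  | zero => simp [shiftSum_multichoose_zero]
  | succ m ih =>
    have h := shiftSum_multichoose_succ (fun r => q ^ r) m
    have hq : shiftSum (fun r => (Nat.multichoose (m + 1) r : ℝ) • q ^ (r + 1)) =
        q * shiftSum (fun r => (Nat.multichoose (m + 1) r : ℝ) • q ^ r) := by
      simp only [← shiftSum_mul_left, pow_succ', mul_smul_comm]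
    rw [ih, hq, ← mul_assoc, ← sub_eq_iff_eq_add, ← one_sub_mul, mul_comm,
      ← PowerSeries.eq_mul_inv_iff_mul_eq (by simp)] at h
    rw [h, pow_succ]

lemma pow_resolvent_eq_resolventMoment (a g : ℝ) (Y : PowerSeries ℝ) (m : ℕ) :
    (X * (1 - X * (C a + C g * Y))⁻¹) ^ m =
      resolventMoment (fun i => a ^ i) (fun j => g ^ j) (fun k => Y ^ k) m := by
  have h (r : ℕ) : mixedMoment (fun i => a ^ i) (fun j => g ^ j) (fun k => Y ^ k) r =
      (C a + C g * Y) ^ r := by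
    rw [mixedMoment, add_pow]
    refine sum_congr rfl fun i _ => ?_
    simp only [PowerSeries.smul_eq_C_mul, map_mul, map_pow, map_natCast]
    ring
  simp only [resolventMoment, h, shiftSum_multichoose_pow, mul_pow]

lemma coeff_resolventMoment (μ γ : ℕ → ℝ) (ψ : ℕ → PowerSeries ℝ) (m n : ℕ) :
    coeff n (resolventMoment μ γ ψ m) =
      if m ≤ n then ∑ rl ∈ antidiagonal (n - m), ∑ i ∈ range (rl.1 + 1),
        (Nat.multichoose m rl.1 * rl.1.choose i : ℝ) *
          (μ i * γ (rl.1 - i) * coeff rl.2 (ψ (rl.1 - i))) else 0 := by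
  rw [resolventMoment, coeff_X_pow_mul']
  refine if_congr Iff.rfl ?_ rfl
  simp only [shiftSum, coeff_mk, map_smul, mixedMoment, map_sum, smul_eq_mul, mul_sum]
  refine sum_congr rfl fun rl _ => sum_congr rfl fun i _ => ?_
  ring

lemma resolventMoment_zero (μ γ : ℕ → ℝ) (ψ : ℕ → PowerSeries ℝ) :
    resolventMoment μ γ ψ 0 = (μ 0 * γ 0) • ψ 0 := by
  simp [resolventMoment, shiftSum_multichoose_zero, mixedMoment]

lemma shiftSum_sub_dvd {D : ℕ} {f g : ℕ → PowerSeries ℝ} (h : ∀ r, X ^ D ∣ f r - g r) :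
    X ^ D ∣ shiftSum f - shiftSum g := by
  choose k hk using h
  refine ⟨shiftSum k, ?_⟩
  rw [sub_eq_iff_eq_add, ← shiftSum_mul_left, ← shiftSum_add]
  congr 1
  funext r
  rw [← hk, sub_add_cancel]

/-- `resolventMoment` gains two orders of accuracy in `ψ`. -/
lemma resolventMoment_sub_dvd {D : ℕ} (μ γ : ℕ → ℝ) {ψ φ : ℕ → PowerSeries ℝ} (h0 : ψ 0 = φ 0)
    (h : ∀ k, X ^ D ∣ ψ k - φ k) (m : ℕ) :
    X ^ (D + 2) ∣ resolventMoment μ γ ψ m - resolventMoment μ γ φ m := by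
  have hmix (r : ℕ) : X ^ D ∣ mixedMoment μ γ ψ r - mixedMoment μ γ φ r := by
    rw [mixedMoment, mixedMoment, ← sum_sub_distrib]
    refine dvd_sum fun i _ => ?_
    rw [← smul_sub]
    rw [PowerSeries.smul_eq_C_mul]
    exact dvd_mul_of_dvd_right (h _) _
  cases m with
  | zero => simp [resolventMoment_zero, h0]
  | succ m =>
    rw [resolventMoment, resolventMoment, ← mul_sub, shiftSum_eq_add_X_mul,
      shiftSum_eq_add_X_mul (fun r => (Nat.multichoose (m + 1) r : ℝ) • mixedMoment μ γ φ r)]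
    have hz : mixedMoment μ γ ψ 0 = mixedMoment μ γ φ 0 := by simp [mixedMoment, h0]
    rw [hz, add_sub_add_left_eq_sub, ← mul_sub, pow_succ X m, mul_assoc, ← mul_assoc X X,
      ← sq, pow_add, mul_comm (X ^ D)]
    refine Dvd.dvd.mul_left (mul_dvd_mul_left _ (shiftSum_sub_dvd fun r => ?_)) _
    rw [← smul_sub]
    rw [PowerSeries.smul_eq_C_mul]
    exact dvd_mul_of_dvd_right (hmix _) _

lemma integral_coeff_resolvent_pow {Ω : Type*} [MeasurableSpace Ω] {P : Measure Ω}
    {a g : Ω → ℝ} {Y : Ω → PowerSeries ℝ} {μ γ : ℕ → ℝ} {ψ : ℕ → PowerSeries ℝ}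
    (hint : ∀ i j k n, Integrable (fun ω => a ω ^ i * g ω ^ j * coeff n (Y ω ^ k)) P)
    (heq : ∀ i j k n, ∫ ω, a ω ^ i * g ω ^ j * coeff n (Y ω ^ k) ∂P =
      μ i * γ j * coeff n (ψ k)) (m n : ℕ) :
    Integrable (fun ω => coeff n ((X * (1 - X * (C (a ω) + C (g ω) * Y ω))⁻¹) ^ m)) P ∧
      ∫ ω, coeff n ((X * (1 - X * (C (a ω) + C (g ω) * Y ω))⁻¹) ^ m) ∂P =
        coeff n (resolventMoment μ γ ψ m) := by
  simp only [pow_resolvent_eq_resolventMoment, coeff_resolventMoment]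
  split_ifs
  · constructor
    · exact integrable_finsetSum _ fun rl _ => integrable_finsetSum _ fun i _ =>
        (hint _ _ _ _).const_mul _
    · rw [integral_finsetSum _ fun rl _ => integrable_finsetSum _ fun i _ =>
        (hint _ _ _ _).const_mul _]
      refine sum_congr rfl fun rl _ => ?_
      rw [integral_finsetSum _ fun i _ => (hint _ _ _ _).const_mul _]
      refine sum_congr rfl fun i _ => ?_
      rw [integral_const_mul, heq]
  · simp

/-- The series `∑ n, X ^ (n + 1) * (T ^ n)₀₀` of the tridiagonal matrix `T = tridiagOf a b`. -/
noncomputable def cornerSeries : ∀ d : ℕ, (Fin (d + 1) → ℝ) → (Fin d → ℝ) → PowerSeries ℝ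
  | 0, a, _ => X * (1 - X * (C (a 0) + C 1 * 0))⁻¹
  | d + 1, a, b =>
    X * (1 - X * (C (a 0) + C (b 0 ^ 2) * cornerSeries d (Fin.tail a) (Fin.tail b)))⁻¹

/-- The expected powers of `cornerSeries`, in terms of the moments of the entries. -/
noncomputable def cornerMoment (μ : ℕ → ℝ) :
    ∀ d : ℕ, (Fin d → ℕ → ℝ) → ℕ → PowerSeries ℝ
  | 0, _ => resolventMoment μ (fun _ => 1) fun k => 0 ^ k
  | d + 1, γ => resolventMoment μ (γ 0) (cornerMoment μ d (Fin.tail γ))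

lemma integral_coeff_cornerSeries_pow {νa : Measure ℝ} [IsProbabilityMeasure νa]
    (ha : ∀ i, Integrable (fun x : ℝ => x ^ i) νa) (d : ℕ) {ν : Fin d → Measure ℝ}
    [∀ i, IsProbabilityMeasure (ν i)]
    (hν : ∀ i j, Integrable (fun x : ℝ => (x ^ 2) ^ j) (ν i)) (m n : ℕ) :
    Integrable (fun ω : (Fin (d + 1) → ℝ) × (Fin d → ℝ) => coeff n (cornerSeries d ω.1 ω.2 ^ m))
        ((Measure.pi fun _ : Fin (d + 1) => νa).prod (Measure.pi ν)) ∧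
      ∫ ω : (Fin (d + 1) → ℝ) × (Fin d → ℝ), coeff n (cornerSeries d ω.1 ω.2 ^ m)
        ∂((Measure.pi fun _ : Fin (d + 1) => νa).prod (Measure.pi ν)) =
      coeff n (cornerMoment (fun i => ∫ x, x ^ i ∂νa) d
        (fun i j => ∫ x, (x ^ 2) ^ j ∂ν i) m) := by
  induction d generalizing m n with
  | zero =>
    have hmp : MeasurePreserving (fun ω : (Fin 1 → ℝ) × (Fin 0 → ℝ) => ω.1 0)
        ((Measure.pi fun _ : Fin 1 => νa).prod (Measure.pi ν)) νa :=
      (measurePreserving_eval (fun _ : Fin 1 => νa) 0).comp measurePreserving_fst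
    have hi (i : ℕ) := hmp.integrable_comp_of_integrable (ha i)
    have he (i : ℕ) := (integral_map hmp.aemeasurable
      (hmp.map_eq ▸ (ha i).aestronglyMeasurable)).symm
    simp only [hmp.map_eq] at he
    refine integral_coeff_resolvent_pow (a := fun ω : (Fin 1 → ℝ) × (Fin 0 → ℝ) => ω.1 0)
      (g := fun _ => 1) (Y := fun _ => 0) ?_ ?_ m n
    · intro i j k n
      simpa using (hi i).mul_const _
    · intro i j k n
      simp only [one_pow, mul_one]
      rw [integral_mul_const, he]
  | succ d ih =>
    have : ∀ i, IsProbabilityMeasure (Fin.tail ν i) := fun i => inferInstanceAs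
      (IsProbabilityMeasure (ν i.succ))
    have hmp := measurePreserving_head_head_tails νa ν
    have IH := ih (ν := Fin.tail ν) fun i j => hν i.succ j
    have hint (i j k n : ℕ) := (ha i).mul_prod ((hν 0 j).mul_prod (IH k n).1)
    refine integral_coeff_resolvent_pow
      (a := fun ω : (Fin (d + 2) → ℝ) × (Fin (d + 1) → ℝ) => ω.1 0) (g := fun ω => ω.2 0 ^ 2)
      (Y := fun ω => cornerSeries d (Fin.tail ω.1) (Fin.tail ω.2)) ?_ ?_ m n
    · intro i j k n
      simpa [Function.comp_def, mul_assoc] using hmp.integrable_comp_of_integrable (hint i j k n)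
    · intro i j k n
      have he := integral_map hmp.aemeasurable
        (hmp.map_eq ▸ (hint i j k n).aestronglyMeasurable)
      rw [hmp.map_eq] at he
      have h₁ := integral_prod_mul (μ := ν 0)
        (ν := (Measure.pi fun _ : Fin (d + 1) => νa).prod (Measure.pi (Fin.tail ν)))
        (fun x => (x ^ 2) ^ j) fun ω => coeff n (cornerSeries d ω.1 ω.2 ^ k)
      have h₂ := integral_prod_mul (μ := νa)
        (ν := (ν 0).prod ((Measure.pi fun _ : Fin (d + 1) => νa).prod (Measure.pi (Fin.tail ν))))
        (fun x => x ^ i) fun ω => (ω.1 ^ 2) ^ j * coeff n (cornerSeries d ω.2.1 ω.2.2 ^ k)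
      rw [h₁, (IH k n).2] at h₂
      simp only [mul_assoc]
      exact he.symm.trans h₂

lemma tendsto_coeff_resolventMoment {ι : Type*} {l : Filter ι} {μ : ℕ → ℝ} {γ : ι → ℕ → ℝ}
    {γ' : ℕ → ℝ} {ψ : ι → ℕ → PowerSeries ℝ} {ψ' : ℕ → PowerSeries ℝ}
    (hγ : ∀ j, Filter.Tendsto (fun N => γ N j) l (nhds (γ' j)))
    (hψ : ∀ k n, Filter.Tendsto (fun N => coeff n (ψ N k)) l (nhds (coeff n (ψ' k)))) (m n : ℕ) :
    Filter.Tendsto (fun N => coeff n (resolventMoment μ (γ N) (ψ N) m)) l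
      (nhds (coeff n (resolventMoment μ γ' ψ' m))) := by
  simp only [coeff_resolventMoment]
  split_ifs
  · exact tendsto_finsetSum _ fun rl _ => tendsto_finsetSum _ fun i _ =>
      (((hγ _).const_mul _).mul (hψ _ _)).const_mul _
  · exact tendsto_const_nhds

lemma tendsto_coeff_cornerMoment {ι : Type*} {l : Filter ι} (μ : ℕ → ℝ) (d : ℕ)
    {γ : ι → Fin d → ℕ → ℝ} {γ' : Fin d → ℕ → ℝ}
    (hγ : ∀ i j, Filter.Tendsto (fun N => γ N i j) l (nhds (γ' i j))) (m n : ℕ) :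
    Filter.Tendsto (fun N => coeff n (cornerMoment μ d (γ N) m)) l
      (nhds (coeff n (cornerMoment μ d γ' m))) := by
  induction d generalizing m n with
  | zero => exact tendsto_const_nhds
  | succ d ih =>
    exact tendsto_coeff_resolventMoment (hγ 0)
      (fun k n => ih (γ := fun N => Fin.tail (γ N)) (γ' := Fin.tail γ')
        (fun i j => hγ i.succ j) k n) m n

lemma cornerMoment_zero {μ : ℕ → ℝ} (hμ : μ 0 = 1) (d : ℕ) {γ : Fin d → ℕ → ℝ}
    (hγ : ∀ i, γ i 0 = 1) : cornerMoment μ d γ 0 = 1 := by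
  induction d with
  | zero => simp [cornerMoment, resolventMoment_zero, hμ]
  | succ d ih =>
    rw [cornerMoment, resolventMoment_zero, ih (γ := Fin.tail γ) fun i => hγ i.succ, hμ, hγ,
      mul_one, one_smul]

lemma X_pow_dvd_cornerMoment_sub_pathSeries {α : ℝ} {μ γ : ℕ → ℝ} (hμ0 : μ 0 = 1)
    (hγ0 : γ 0 = 1) (hμ : ∀ i, μ (i + 1) = i * μ (i - 1))
    (hγ : ∀ j, γ (j + 1) = (α + j) * γ j) (d m : ℕ) :
    X ^ (2 * d + 3) ∣ cornerMoment μ d (fun _ => γ) m - pathSeries α m := by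
  have hfix := resolventMoment_pathSeries hμ0 hγ0 hμ hγ
  induction d generalizing m with
  | zero =>
    have hbase : cornerMoment μ 0 (fun _ => γ) m = resolventMoment μ γ (fun k => 0 ^ k) m := by
      have hmix : mixedMoment μ (fun _ => 1) (fun k => 0 ^ k) =
          mixedMoment μ γ (fun k => 0 ^ k) := by
        funext r
        refine sum_congr rfl fun i _ => ?_
        cases r - i <;> simp [hγ0]
      rw [cornerMoment, resolventMoment, resolventMoment, hmix]
    rw [hbase, ← congrFun hfix m]
    refine resolventMoment_sub_dvd (D := 1) μ γ (by simp [pathSeries_zero]) (fun k => ?_) m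
    cases k with
    | zero => simp [pathSeries_zero]
    | succ k =>
      rw [pathSeries_succ]
      simp
  | succ d ih =>
    rw [← congrFun hfix m]
    exact resolventMoment_sub_dvd μ γ
      ((cornerMoment_zero hμ0 d fun _ => hγ0).trans (pathSeries_zero α).symm) ih m

end Resolvent

section Matrix

open PowerSeries Finset

lemma tridiagOf_succ_succ {d : ℕ} (a : Fin (d + 2) → ℝ) (b : Fin (d + 1) → ℝ)
    (i j : Fin (d + 1)) :
    tridiagOf a b i.succ j.succ = tridiagOf (Fin.tail a) (Fin.tail b) i j := by
  simp [tridiagOf, Fin.tail, Fin.succ, Fin.ext_iff]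

lemma tridiagOf_zero_zero {d : ℕ} (a : Fin (d + 1) → ℝ) (b : Fin d → ℝ) :
    tridiagOf a b 0 0 = a 0 := by
  simp [tridiagOf]

lemma tridiagOf_zero_succ {d : ℕ} (a : Fin (d + 2) → ℝ) (b : Fin (d + 1) → ℝ)
    (j : Fin (d + 1)) : tridiagOf a b 0 j.succ = if j = 0 then b 0 else 0 := by
  by_cases h : j = 0
  · simp [tridiagOf, h]
  · simp [tridiagOf, h, (Fin.succ_ne_zero j).symm]

lemma tridiagOf_succ_zero {d : ℕ} (a : Fin (d + 2) → ℝ) (b : Fin (d + 1) → ℝ)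
    (j : Fin (d + 1)) : tridiagOf a b j.succ 0 = if j = 0 then b 0 else 0 := by
  by_cases h : j = 0
  · simp [tridiagOf, h]
  · simp [tridiagOf, h]

lemma mul_inv_one_sub_eq (q : PowerSeries ℝ) :
    X * (1 - X * q)⁻¹ = X + X * q * (X * (1 - X * q)⁻¹) := by
  have h : (1 - X * q) * (1 - X * q)⁻¹ = 1 := PowerSeries.mul_inv_cancel _ (by simp)
  linear_combination X * h

/-- The first column of the resolvent of a tridiagonal matrix, as a formal series. -/
lemma exists_resolvent_column (d : ℕ) (a : Fin (d + 1) → ℝ) (b : Fin d → ℝ) :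
    ∃ G : Fin (d + 1) → PowerSeries ℝ, G 0 = cornerSeries d a b ∧
      ∀ k, G k = (if k = 0 then X else 0) + X * ∑ j, C (tridiagOf a b k j) * G j := by
  induction d with
  | zero =>
    refine ⟨fun _ => cornerSeries 0 a b, rfl, fun k => ?_⟩
    obtain rfl : k = 0 := Subsingleton.elim (α := Fin 1) k 0
    have := mul_inv_one_sub_eq (C (a 0))
    rw [Fin.sum_univ_succ, Fin.sum_univ_zero, tridiagOf_zero_zero]
    simp only [cornerSeries, mul_zero, add_zero, if_true]
    rw [← mul_assoc, ← this]
  | succ d ih =>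
    obtain ⟨G, hG0, hG⟩ := ih (Fin.tail a) (Fin.tail b)
    set S := cornerSeries (d + 1) a b with hS
    have hS' : S = X + X * (C (a 0) + C (b 0 ^ 2) * cornerSeries d (Fin.tail a) (Fin.tail b)) * S :=
      mul_inv_one_sub_eq _
    refine ⟨Fin.cons S fun k => S * C (b 0) * G k, rfl, fun k => ?_⟩
    rw [Fin.sum_univ_succ]
    cases k using Fin.cases with
    | zero =>
      simp only [Fin.cons_zero, Fin.cons_succ, tridiagOf_zero_zero, tridiagOf_zero_succ, if_true]
      rw [Finset.sum_eq_single 0 (by intro j _ hj; simp [hj]) (by simp), hG0]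
      rw [map_pow] at hS'
      simp only [if_true]
      linear_combination hS'
    | succ k =>
      simp only [Fin.cons_zero, Fin.cons_succ, tridiagOf_succ_succ, tridiagOf_succ_zero,
        Fin.succ_ne_zero, if_false]
      have hsum : ∑ j, C (tridiagOf (Fin.tail a) (Fin.tail b) k j) * (S * C (b 0) * G j) =
          S * C (b 0) * ∑ j, C (tridiagOf (Fin.tail a) (Fin.tail b) k j) * G j := by
        rw [mul_sum]
        exact sum_congr rfl fun j _ => by ring
      rw [hsum]
      have h := hG k
      split_ifs at h ⊢
      · linear_combination S * C (b 0) * h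
      · rw [map_zero]
        linear_combination S * C (b 0) * h

lemma coeff_cornerSeries (d : ℕ) (a : Fin (d + 1) → ℝ) (b : Fin d → ℝ) (n : ℕ) :
    coeff (n + 1) (cornerSeries d a b) = (tridiagOf a b ^ n) 0 0 := by
  obtain ⟨G, hG0, hG⟩ := exists_resolvent_column d a b
  have key (n : ℕ) : ∀ k, coeff (n + 1) (G k) = (tridiagOf a b ^ n) k 0 := by
    induction n with
    | zero =>
      intro k
      have h0 (j) : constantCoeff (G j) = 0 := by
        rw [hG]
        split_ifs <;> simp
      rw [hG, map_add, coeff_succ_X_mul]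
      split_ifs with hk <;> simp [hk, h0, coeff_one_X]
    | succ n ih =>
      intro k
      rw [hG, map_add, coeff_succ_X_mul, pow_succ', Matrix.mul_apply, map_sum]
      have : coeff (n + 1 + 1) (if k = 0 then (X : PowerSeries ℝ) else 0) = 0 := by
        split_ifs <;> simp [coeff_X]
      simp [this, ih]
  rw [← hG0, key]

lemma pathCount_eq_zero {α : ℝ} {m n : ℕ} (h : n < m) : pathCount α m n = 0 := by
  induction n generalizing m with
  | zero => cases m with
    | zero => omega
    | succ m => rw [pathCount]
  | succ n ih => cases m with
    | zero => omega
    | succ m => rw [pathCount_succ_succ, ih (by omega), ih (by omega), mul_zero, add_zero]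

lemma sum_jacobiM_mul (α : ℝ) (p k : ℕ) (hk : k < p + 1) (f : ℕ → ℝ) :
    ∑ j : Fin (p + 1), jacobiM α (p + 1) ⟨k, hk⟩ j * f j =
      (if k < p then √(α + k + 1) * f (k + 1) else 0) +
        if k = 0 then 0 else √(α + (k - 1 : ℕ) + 1) * f (k - 1) := by
  have h (j : Fin (p + 1)) : jacobiM α (p + 1) ⟨k, hk⟩ j * f j =
      (if (j : ℕ) = k + 1 then √(α + k + 1) * f (k + 1) else 0) +
        if (j : ℕ) + 1 = k then √(α + (k - 1 : ℕ) + 1) * f (k - 1) else 0 := by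
    simp only [jacobiM]
    split_ifs with h1 h2 h3 h4 h5 h6 <;> first | omega | skip
    · rw [← h1, add_zero]
    · rw [← h5, Nat.add_sub_cancel, zero_add]
    · simp
  rw [sum_congr rfl fun j _ => h j, sum_add_distrib]
  congr 1
  · rw [Fin.sum_univ_eq_sum_range
      (fun j => if j = k + 1 then √(α + k + 1) * f (k + 1) else 0) (p + 1), sum_ite_eq']
    simp
  · rw [Fin.sum_univ_eq_sum_range
      (fun j => if j + 1 = k then √(α + (k - 1 : ℕ) + 1) * f (k - 1) else 0) (p + 1)]
    cases k with
    | zero => simp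
    | succ k =>
      simp only [Nat.add_right_cancel_iff]
      rw [sum_ite_eq', if_pos (mem_range.2 (by omega)), if_neg (Nat.succ_ne_zero k)]

/-- Entries of powers of the truncated Jacobi matrix count weighted paths, as long as these
paths do not reach the truncation level. -/
lemma jacobiM_pow_apply_zero {α : ℝ} (hα : 0 < α) (p n : ℕ) (k : Fin (p + 1))
    (hnk : n + k ≤ 2 * p) :
    (jacobiM α (p + 1) ^ n) k 0 =
      (∏ i ∈ range (k : ℕ), √(α + i + 1)) * pathCount α (k + 1) (n + 1) := by
  induction n generalizing k with
  | zero =>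
    obtain ⟨k, hk⟩ := k
    cases k with
    | zero => simp [pathCount]
    | succ k =>
      rw [pathCount_eq_zero (by simp), pow_zero, Matrix.one_apply_ne (by simp [Fin.ext_iff]),
        mul_zero]
  | succ n ih =>
    obtain ⟨k, hk⟩ := k
    simp only at hnk
    have hsum : (jacobiM α (p + 1) ^ (n + 1)) ⟨k, hk⟩ 0 =
        ∑ j : Fin (p + 1), jacobiM α (p + 1) ⟨k, hk⟩ j *
          ((∏ i ∈ range (j : ℕ), √(α + i + 1)) * pathCount α (j + 1) (n + 1)) := by
      rw [pow_succ', Matrix.mul_apply]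
      refine sum_congr rfl fun j _ => ?_
      by_cases hj : jacobiM α (p + 1) ⟨k, hk⟩ j = 0
      · simp [hj]
      · rw [ih j]
        simp only [jacobiM] at hj
        split_ifs at hj <;> first | omega | contradiction
    have hup : (if k < p then √(α + k + 1) *
        ((∏ i ∈ range (k + 1), √(α + i + 1)) * pathCount α (k + 1 + 1) (n + 1)) else 0) =
        (∏ i ∈ range k, √(α + i + 1)) * ((α + k + 1) * pathCount α (k + 2) (n + 1)) := by
      split_ifs with hkp
      · have hsq := Real.mul_self_sqrt (show 0 ≤ α + k + 1 by positivity)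
        rw [prod_range_succ]
        linear_combination (∏ i ∈ range k, √(α + i + 1)) * pathCount α (k + 2) (n + 1) * hsq
      · rw [pathCount_eq_zero (by omega)]
        simp
    rw [hsum, sum_jacobiM_mul α p k hk
      fun j => (∏ i ∈ range j, √(α + i + 1)) * pathCount α (j + 1) (n + 1), hup]
    simp only
    rw [pathCount_succ_succ α k (n + 1)]
    cases k with
    | zero => simp [pathCount]
    | succ k =>
      simp only [Nat.add_sub_cancel, Nat.succ_ne_zero, if_false, prod_range_succ]
      ring

lemma u_eq_pathCount {α : ℝ} (hα : 0 < α) (p : ℕ) : u α p = pathCount α 1 (2 * p + 1) := by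
  rw [u, jacobiM_pow_apply_zero hα p (2 * p) 0 (by simp)]
  simp

end Matrix

/-- Gaussian β-ensemble corner-moment convergence: with `β = 2α/N`, the mean `2p`-th
moment `m_p(N) = E[(T_N^{2p})_{0,0}]` of the `(p+1) × (p+1)` tridiagonal model whose
diagonal is i.i.d. standard Gaussian and whose `j`-th off-diagonal entry is
`χ̃_{2(N-j)α/N}`-distributed (`j = 1, …, p`), converges to `u_p(α)` as `N → ∞`. -/
theorem mean_corner_moment_tendsto_u (α : ℝ) (hα : 0 < α) (p : ℕ) :
    Filter.Tendsto
      (fun N : ℕ =>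
        ∫ ω : (Fin (p + 1) → ℝ) × (Fin p → ℝ),
          ((tridiagOf ω.1 ω.2) ^ (2 * p)) 0 0
          ∂((Measure.pi fun _ : Fin (p + 1) => gaussianReal 0 1).prod
              (Measure.pi fun i : Fin p =>
                tildeChiMeasure (α * ((N : ℝ) - ((i : ℕ) + 1)) / N))))
      Filter.atTop (nhds (u α p)) := by
  set μ : ℕ → ℝ := fun i => ∫ x, x ^ i ∂gaussianReal 0 1 with hμ
  set γ : ℕ → ℝ := fun j => (ascPochhammer ℝ j).eval α with hγ
  have hlim : u α p = PowerSeries.coeff (2 * p + 1) (cornerMoment μ p (fun _ => γ) 1) := by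
    have h := X_pow_dvd_cornerMoment_sub_pathSeries (α := α) (μ := μ) (γ := γ) (by simp [hμ])
      (by simp [hγ]) integral_pow_succ_gaussianReal
      (fun j => by simp only [hγ, ascPochhammer_succ_eval]; ring) p 1
    have hc := PowerSeries.X_pow_dvd_iff.1 h (2 * p + 1) (by omega)
    rw [map_sub, sub_eq_zero] at hc
    rw [hc, u_eq_pathCount hα, pathSeries, PowerSeries.coeff_mk]
  have hparam (i : Fin p) : Filter.Tendsto
      (fun N : ℕ => α * ((N : ℝ) - ((i : ℕ) + 1)) / N) Filter.atTop (nhds α) := by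
    have h := (tendsto_const_div_atTop_nhds_zero_nat (α * ((i : ℕ) + 1) : ℝ)).const_sub α
    rw [sub_zero] at h
    refine h.congr' ?_
    filter_upwards [Filter.eventually_gt_atTop 0] with N hN
    field_simp
  rw [hlim]
  refine (tendsto_coeff_cornerMoment μ p (γ := fun (N : ℕ) i j =>
    (ascPochhammer ℝ j).eval (α * ((N : ℝ) - ((i : ℕ) + 1)) / N)) (fun i j =>
      ((ascPochhammer ℝ j).continuous.tendsto α).comp (hparam i)) 1 (2 * p + 1)).congr' ?_
  filter_upwards [Filter.eventually_gt_atTop p] with N hN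
  have hpos (i : Fin p) : 0 < α * ((N : ℝ) - ((i : ℕ) + 1)) / N := by
    have hi : ((i : ℕ) : ℝ) + 1 < N := by exact_mod_cast lt_of_le_of_lt i.isLt hN
    have : (0 : ℝ) < N := by exact_mod_cast (Nat.zero_le p).trans_lt hN
    exact div_pos (mul_pos hα (sub_pos.2 hi)) this
  have hprob (i : Fin p) := isProbabilityMeasure_tildeChiMeasure (hpos i)
  have h := (integral_coeff_cornerSeries_pow integrable_pow_gaussianReal p
    (fun i j => (integrable_and_integral_pow_tildeChiMeasure (hpos i) j).1) 1 (2 * p + 1)).2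
  simp only [pow_one, coeff_cornerSeries,
    fun i j => (integrable_and_integral_pow_tildeChiMeasure (hpos i) j).2] at h
  exact h.symm
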